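/- arXiv:2411.08445 — 12 statements merged into one kernel-verified Lean document; each statement's English description precedes it below -/
import Mathlib

section
/- Let a and b be effects on a complex Hilbert space H. Then a and b are partially ortho-coexistent if and only if both a ⩕ b and a ⩖ b are effects. -/
variable {H : Type*} [NormedAddCommGroup H] [InnerProductSpace ℂ H] [CompleteSpace H]

/-- The absolute value of a bounded operator. -/
noncomputable def oabs (u : H →L[ℂ] H) : H →L[ℂ] H := CFC.sqrt (star u * u)

/-- A Hilbert space effect: between 0 and I in the Loewner order. -/
def IsEffect (a : H →L[ℂ] H) : Prop := 0 ≤ a ∧ a ≤ 1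

/-- The operation dotWedge. -/
noncomputable def dotWedge (a b : H →L[ℂ] H) : H →L[ℂ] H :=
  ((1:ℂ)/2) • (a + b - oabs (a - b))

/-- The operation dotVee. -/
noncomputable def dotVee (a b : H →L[ℂ] H) : H →L[ℂ] H :=
  ((1:ℂ)/2) • (a + b + oabs (a - b))

/-- Effects a, b are partially ortho-coexistent. -/
def PartiallyOrthoCoexistent (a b : H →L[ℂ] H) : Prop :=
  ∃ x y z : H →L[ℂ] H, IsEffect x ∧ IsEffect y ∧ IsEffect z ∧
    a = x + y ∧ b = x + z ∧ IsEffect (x + y + z) ∧ y * z = 0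

/-- If `y` and `z` are positive and orthogonal, then `|y - z| = y + z`. -/
lemma oabs_sub_of_mul_eq_zero {y z : H →L[ℂ] H} (hy : 0 ≤ y) (hz : 0 ≤ z) (hyz : y * z = 0) :
    oabs (y - z) = y + z := by
  have hys : star y = y := (IsSelfAdjoint.of_nonneg hy).star_eq
  have hzs : star z = z := (IsSelfAdjoint.of_nonneg hz).star_eq
  have hzy : z * y = 0 := by
    simpa [hys, hzs] using congrArg star hyz
  refine CFC.sqrt_unique ?_ (add_nonneg hy hz)
  simp [hys, hzs, mul_add, add_mul, mul_sub, sub_mul, hyz, hzy]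

/-- If `y` and `z` are positive and orthogonal, then `(x + y) ⩕ (x + z) = x`. -/
lemma dotWedge_add_add {x y z : H →L[ℂ] H} (hy : 0 ≤ y) (hz : 0 ≤ z) (hyz : y * z = 0) :
    dotWedge (x + y) (x + z) = x := by
  rw [dotWedge, add_sub_add_left_eq_sub, oabs_sub_of_mul_eq_zero hy hz hyz]
  module

/-- If `y` and `z` are positive and orthogonal, then `(x + y) ⩖ (x + z) = x + y + z`. -/
lemma dotVee_add_add {x y z : H →L[ℂ] H} (hy : 0 ≤ y) (hz : 0 ≤ z) (hyz : y * z = 0) :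
    dotVee (x + y) (x + z) = x + y + z := by
  rw [dotVee, add_sub_add_left_eq_sub, oabs_sub_of_mul_eq_zero hy hz hyz]
  module

theorem partiallyOrthoCoexistent_iff (a b : H →L[ℂ] H)
    (ha : IsEffect a) (hb : IsEffect b) :
    PartiallyOrthoCoexistent a b ↔ IsEffect (dotWedge a b) ∧ IsEffect (dotVee a b) := by
  constructor
  · rintro ⟨x, y, z, hx, hy, hz, rfl, rfl, hxyz, hyz⟩
    rw [dotWedge_add_add hy.1 hz.1 hyz, dotVee_add_add hy.1 hz.1 hyz]
    exact ⟨hx, hxyz⟩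
  · rintro ⟨hwedge, hvee⟩
    have hsa : IsSelfAdjoint (a - b) :=
      (IsSelfAdjoint.of_nonneg ha.1).sub (IsSelfAdjoint.of_nonneg hb.1)
    obtain ⟨y, z, hy, hz, hyz, hsub⟩ :
        ∃ y z : H →L[ℂ] H, 0 ≤ y ∧ 0 ≤ z ∧ y * z = 0 ∧ y - z = a - b :=
      ⟨(a - b)⁺, (a - b)⁻, CFC.posPart_nonneg _, CFC.negPart_nonneg _,
        CFC.posPart_mul_negPart _, CFC.posPart_sub_negPart _ hsa⟩
    obtain ⟨x, rfl⟩ : ∃ x, a = x + y := ⟨a - y, by abel⟩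
    obtain rfl : b = x + z := by
      rw [sub_eq_sub_iff_add_eq_add] at hsub
      apply add_left_cancel (a := y)
      rw [hsub]
      abel
    rw [dotWedge_add_add hy hz hyz] at hwedge
    rw [dotVee_add_add hy hz hyz] at hvee
    exact ⟨x, y, z, hwedge, ⟨hy, (le_add_of_nonneg_left hwedge.1).trans ha.2⟩,
      ⟨hz, (le_add_of_nonneg_left hwedge.1).trans hb.2⟩, rfl, rfl, hvee, hyz⟩
end

section
/- Let a and b be effects on a complex Hilbert space H. Then a and b are partially ortho-coexistent if and only if there exist effects b₁, b₂ such that b = b₁ + b₂, b₁ ≤ a ⩕ b and b₂ ≤ I - a. -/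
variable {H : Type*} [NormedAddCommGroup H] [InnerProductSpace ℂ H] [CompleteSpace H]

theorem partiallyOrthoCoexistent_iff_decomp_right (a b : H →L[ℂ] H)
    (ha : IsEffect a) (hb : IsEffect b) :
    PartiallyOrthoCoexistent a b ↔
      ∃ b₁ b₂ : H →L[ℂ] H, IsEffect b₁ ∧ IsEffect b₂ ∧ b = b₁ + b₂ ∧
        b₁ ≤ dotWedge a b ∧ b₂ ≤ 1 - a := by
  constructor
  · rintro ⟨x, y, z, hx, hy, hz, rfl, rfl, hxyz, hyz⟩
    have hzy : z * y = 0 := by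
      have h := congrArg star hyz
      rwa [star_mul, (IsSelfAdjoint.of_nonneg hy.1).star_eq,
        (IsSelfAdjoint.of_nonneg hz.1).star_eq, star_zero] at h
    have habs : oabs (x + y - (x + z)) = y + z := by
      refine CFC.sqrt_unique ?_ (add_nonneg hy.1 hz.1)
      rw [add_sub_add_left_eq_sub, star_sub, (IsSelfAdjoint.of_nonneg hy.1).star_eq,
        (IsSelfAdjoint.of_nonneg hz.1).star_eq]
      simp only [add_mul, mul_add, sub_mul, mul_sub, hyz, hzy]
      abel
    refine ⟨x, z, hx, hz, rfl, le_of_eq ?_, ?_⟩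
    · rw [dotWedge, habs]
      module
    · rw [le_sub_iff_add_le, add_comm]
      exact hxyz.2
  · rintro ⟨b₁, b₂, hb₁, hb₂, hb_eq, hle, hle'⟩
    have hsa : IsSelfAdjoint (a - b) :=
      (IsSelfAdjoint.of_nonneg ha.1).sub (IsSelfAdjoint.of_nonneg hb.1)
    have hsub : (a - b)⁺ - (a - b)⁻ = a - b := CFC.posPart_sub_negPart (a - b) hsa
    have hadd : (a - b)⁺ + (a - b)⁻ = oabs (a - b) := CFC.posPart_add_negPart (a - b) hsa
    have hpos : 0 ≤ (a - b)⁺ := CFC.posPart_nonneg _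
    have hneg : 0 ≤ (a - b)⁻ := CFC.negPart_nonneg _
    have hmul : (a - b)⁺ * (a - b)⁻ = 0 := CFC.posPart_mul_negPart _
    generalize (a - b)⁺ = y at *
    generalize (a - b)⁻ = z at *
    have hw : 0 ≤ dotWedge a b := hb₁.1.trans hle
    have hay : a = dotWedge a b + y := by
      rw [dotWedge, ← hadd, ← sub_eq_zero]
      rw [eq_sub_iff_add_eq] at hsub
      rw [← hsub]
      module
    have hbz : b = dotWedge a b + z := by
      rw [dotWedge, ← hadd, ← sub_eq_zero]
      rw [eq_sub_iff_add_eq] at hsub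
      rw [← hsub]
      module
    have hwa : dotWedge a b ≤ a := (le_add_of_nonneg_right hpos).trans hay.ge
    have hya : y ≤ a := (le_add_of_nonneg_left hw).trans hay.ge
    have hzb : z ≤ b := (le_add_of_nonneg_left hw).trans hbz.ge
    refine ⟨dotWedge a b, y, z, ⟨hw, hwa.trans ha.2⟩, ⟨hpos, hya.trans ha.2⟩,
      ⟨hneg, hzb.trans hb.2⟩, hay, hbz, ⟨add_nonneg (add_nonneg hw hpos) hneg, ?_⟩, hmul⟩
    have hzb₂ : z ≤ b₂ := by
      have h : b₁ + z ≤ b₁ + b₂ := by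
        rw [← hb_eq]
        exact (add_le_add_left hle z).trans hbz.ge
      exact le_of_add_le_add_left h
    rw [← hay]
    calc a + z ≤ a + (1 - a) := add_le_add_right (hzb₂.trans hle') a
      _ = 1 := add_sub_cancel a 1
end

section
/- Let p and q be (self-adjoint idempotent) projections on a complex Hilbert space H. If p ⩕ q ≥ 0, then p q = q p. -/
variable {H : Type*} [NormedAddCommGroup H] [InnerProductSpace ℂ H] [CompleteSpace H]

/-- A self-adjoint element of a C⋆-ring whose square vanishes is zero. -/
theorem IsSelfAdjoint.eq_zero_of_mul_self {A : Type*} [NonUnitalNormedRing A] [StarRing A]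
    [CStarRing A] {a : A} (ha : IsSelfAdjoint a) (h : a * a = 0) : a = 0 := by
  rw [← CStarRing.star_mul_self_eq_zero_iff, ha.star_eq, h]

/-- The square of the difference of two idempotents commutes with the first of them. -/
theorem IsIdempotentElem.commute_sub_mul_sub {R : Type*} [Ring R] {p q : R}
    (hp : IsIdempotentElem p) (hq : IsIdempotentElem q) : Commute ((p - q) * (p - q)) p := by
  have hp' (x : R) : p * (p * x) = p * x := by rw [← mul_assoc, hp.eq]
  simp only [Commute, SemiconjBy, mul_sub, sub_mul, mul_assoc, hp.eq, hq.eq, hp']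
  abel

/-- The commutator of two idempotents is, up to sign, a square root of `d * d - d`, where
`d = (p - q) * (p - q)`. -/
theorem IsIdempotentElem.commutator_mul_self {R : Type*} [Ring R] {p q : R}
    (hp : IsIdempotentElem p) (hq : IsIdempotentElem q) :
    (p * q - q * p) * (p * q - q * p) =
      (p - q) * (p - q) * ((p - q) * (p - q)) - (p - q) * (p - q) := by
  have hp' (x : R) : p * (p * x) = p * x := by rw [← mul_assoc, hp.eq]
  have hq' (x : R) : q * (q * x) = q * x := by rw [← mul_assoc, hq.eq]
  simp only [mul_sub, sub_mul, mul_assoc, hp.eq, hq.eq, hp', hq']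
  abel

/-- If `0 ≤ r ≤ 1` then `r * r ≤ r`. -/
theorem mul_self_le_self_of_nonneg_of_le_one {A : Type*} [Ring A] [StarRing A]
    [PartialOrder A] [StarOrderedRing A] {r : A} (h0 : 0 ≤ r) (h1 : r ≤ 1) : r * r ≤ r := by
  rw [← sub_nonneg] at h1 ⊢
  have h : r - r * r = r * (1 - r) * r + (1 - r) * r * (1 - r) := by noncomm_ring
  rw [h]
  exact add_nonneg (conjugate_nonneg_of_nonneg h1 h0) (conjugate_nonneg_of_nonneg h0 h1)

/-- If a square root `r` of `(p - q)²` commutes with the projection `p` and satisfies `r ≤ p + q`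
and `r * r ≤ r`, then `p` acts as the identity on `r - r * r`. -/
theorem IsIdempotentElem.sub_mul_self_mul_eq {A : Type*} [Ring A] [StarRing A]
    [PartialOrder A] [StarOrderedRing A] {p q r : A} (hp : IsIdempotentElem p)
    (hps : IsSelfAdjoint p) (hq : IsIdempotentElem q) (hr : r * r = (p - q) * (p - q))
    (hrp : Commute r p) (hle : r ≤ p + q) (hrr : r * r ≤ r) :
    (r - r * r) * p = r - r * r := by
  have hs : IsSelfAdjoint (1 - p) := (IsSelfAdjoint.one A).sub hps
  have hc : Commute (r - r * r) (1 - p) :=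
    (Commute.one_right _).sub_right (hrp.sub_left (hrp.mul_left hrp))
  have hconj : (1 - p) * (r - r * r) * (1 - p) = (r - r * r) * (1 - p) := by
    rw [← hc.eq, mul_assoc, hp.one_sub.eq]
  have hsq : (1 - p) * (p + q) * (1 - p) = (1 - p) * (r * r) * (1 - p) := by
    have hp' (x : A) : p * (p * x) = p * x := by rw [← mul_assoc, hp.eq]
    rw [hr]
    simp only [mul_sub, sub_mul, mul_add, add_mul, mul_assoc, mul_one, one_mul, hp.eq, hq.eq, hp']
    abel
  have h1 : (1 - p) * (r - r * r) * (1 - p) ≤ 0 := by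
    rw [mul_sub (1 - p) r, sub_mul _ _ (1 - p), sub_nonpos, ← hsq]
    exact hs.conjugate_le_conjugate hle
  have h2 : 0 ≤ (1 - p) * (r - r * r) * (1 - p) := hs.conjugate_nonneg (sub_nonneg.2 hrr)
  have h3 := le_antisymm h1 h2
  rw [hconj, mul_sub, mul_one, sub_eq_zero] at h3
  exact h3.symm

theorem projections_commute_of_dotWedge_nonneg (p q : H →L[ℂ] H)
    (hp₁ : IsSelfAdjoint p) (hp₂ : IsIdempotentElem p)
    (hq₁ : IsSelfAdjoint q) (hq₂ : IsIdempotentElem q)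
    (h : 0 ≤ dotWedge p q) :
    p * q = q * p := by
  have hstar : star (p - q) * (p - q) = (p - q) * (p - q) := by rw [(hp₁.sub hq₁).star_eq]
  have hdp := hp₂.commute_sub_mul_sub hq₂
  have hdq : Commute ((p - q) * (p - q)) q := by
    simpa only [← neg_sub q p, neg_mul_neg] using hq₂.commute_sub_mul_sub hp₂
  have hr2 : oabs (p - q) * oabs (p - q) = (p - q) * (p - q) := by
    rw [← hstar]; exact CFC.sqrt_mul_sqrt_self _ (star_mul_self_nonneg _)
  have hr0 : 0 ≤ oabs (p - q) := CFC.sqrt_nonneg _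
  have hrp : Commute (oabs (p - q)) p := by
    rw [oabs, hstar]; exact hdp.cfcₙ_nnreal _
  have hrq : Commute (oabs (p - q)) q := by
    rw [oabs, hstar]; exact hdq.cfcₙ_nnreal _
  have hr1 : oabs (p - q) ≤ 1 := by
    have hd1 : (p - q) * (p - q) ≤ 1 := by
      have hs : IsSelfAdjoint (1 - p - q) := ((IsSelfAdjoint.one _).sub hp₁).sub hq₁
      have hd : 1 - (p - q) * (p - q) = star (1 - p - q) * (1 - p - q) := by
        rw [hs.star_eq]
        simp only [mul_sub, sub_mul, mul_one, one_mul, hp₂.eq, hq₂.eq]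
        abel
      rw [← sub_nonneg, hd]
      exact star_mul_self_nonneg _
    rw [oabs, hstar, ← CFC.sqrt_one (A := H →L[ℂ] H)]
    exact CFC.sqrt_le_sqrt _ _ hd1
  have hle : oabs (p - q) ≤ p + q := by
    have h2 := add_nonneg h h
    rw [dotWedge, ← add_smul] at h2
    norm_num at h2
    exact h2
  generalize oabs (p - q) = r at *
  have hrr := mul_self_le_self_of_nonneg_of_le_one hr0 hr1
  have hmp := hp₂.sub_mul_self_mul_eq hp₁ hq₂ hr2 hrp hle hrr
  have hmq := hq₂.sub_mul_self_mul_eq hq₁ hp₂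
    (by rw [hr2, ← neg_sub q p, neg_mul_neg]) hrq (by rwa [add_comm]) hrr
  have hmr : (r - r * r) * (r * r) = 0 := by
    have hpq : (r - r * r) * (p - q) = 0 := by rw [mul_sub, hmp, hmq, sub_self]
    calc (r - r * r) * (r * r) = (r - r * r) * ((p - q) * (p - q)) := congrArg _ hr2
      _ = 0 := by rw [← mul_assoc, hpq, zero_mul]
  have hdd : (p - q) * (p - q) * ((p - q) * (p - q)) = (p - q) * (p - q) := by
    have hrs : IsSelfAdjoint r := .of_nonneg hr0
    have hmrs : IsSelfAdjoint ((r - r * r) * r) := by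
      simp only [IsSelfAdjoint, star_mul, star_sub, hrs.star_eq]
      noncomm_ring
    have hms : IsSelfAdjoint (r - r * r) := .of_nonneg (sub_nonneg.2 hrr)
    have hm1 : (r - r * r) * r = 0 := hmrs.eq_zero_of_mul_self <| by
      calc (r - r * r) * r * ((r - r * r) * r) = (r - r * r) * (r * r) * (r - r * r) := by
            noncomm_ring
        _ = 0 := by rw [hmr, zero_mul]
    have hm : r - r * r = 0 := hms.eq_zero_of_mul_self <| by
      rw [mul_sub, ← mul_assoc, hm1, zero_mul, sub_zero]
    rw [← hr2, ← sub_eq_zero.1 hm, ← sub_eq_zero.1 hm]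
  rw [← sub_eq_zero, ← CStarRing.star_mul_self_eq_zero_iff, star_sub, star_mul, star_mul,
    hp₁.star_eq, hq₁.star_eq, ← neg_sub (p * q), neg_mul, hp₂.commutator_mul_self hq₂, hdd,
    sub_self, neg_zero]
end

section
/- Let a and b be effects on a complex Hilbert space H with a b = b a. Then a and b are partially ortho-coexistent. -/
variable {H : Type*} [NormedAddCommGroup H] [InnerProductSpace ℂ H] [CompleteSpace H]

/-- If `p` and `q` are orthogonal positive operators commuting with a positive operator `c`, then
any bound `p - q ≤ c` improves to `p ≤ c`. -/
lemma le_of_sub_le_of_mul_eq_zero {c p q : H →L[ℂ] H} (hc : 0 ≤ c) (hp : 0 ≤ p) (hq : 0 ≤ q)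
    (hpq : p * q = 0) (hcp : Commute c p) (hcq : Commute c q) (h : p - q ≤ c) : p ≤ c := by
  have hqp : q * p = 0 := by
    simpa [(IsSelfAdjoint.of_nonneg hp).star_eq, (IsSelfAdjoint.of_nonneg hq).star_eq] using
      congrArg star hpq
  have hcpq : Commute p q := hpq.trans hqp.symm
  have ht : IsSelfAdjoint (c - p) := (IsSelfAdjoint.of_nonneg hc).sub (.of_nonneg hp)
  set t := c - p with ht_def
  set n := t⁻ with hn_def
  have hn : 0 ≤ n := CFC.negPart_nonneg t
  have hn_comm {s : H →L[ℂ] H} (hs : Commute t s) : Commute n s := hs.cfcₙ_real _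
  have htp : Commute t p := hcp.sub_left (.refl p)
  have htq : Commute t q := hcq.sub_left hcpq
  have hnp := hn_comm htp
  have hnq := hn_comm htq
  have hnt : n * t = -(n * n) := by
    conv_lhs => rw [← CFC.posPart_sub_negPart t ht]
    simp [mul_sub, hn_def]
  have hnn : Commute n t := hn_comm (.refl t)
  have h₁ : 0 ≤ n * p - n * n := by
    have := (hnn.add_right hnp).mul_nonneg hn (by simpa [ht_def] using hc)
    rwa [mul_add, hnt, neg_add_eq_sub] at this
  have h₂ : 0 ≤ n * q - n * n := by
    have := (hnn.add_right hnq).mul_nonneg hn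
      (by rw [ht_def, sub_add]; exact sub_nonneg.mpr h)
    rwa [mul_add, hnt, neg_add_eq_sub] at this
  have hn2 : 0 ≤ n * n := (Commute.refl n).mul_nonneg hn hn
  have hnqn : Commute n (n * q) := (Commute.refl n).mul_right hnq
  have hpnq : Commute p (n * q) := hnp.symm.mul_right hcpq
  have h₃ : 0 ≤ (n * p - n * n) * (n * q) :=
    ((hnqn.mul_left hpnq).sub_left (hnqn.mul_left hnqn)).mul_nonneg h₁
      (hnq.mul_nonneg hn hq)
  have hn' : Commute n (n * q - n * n) := hnqn.sub_right ((Commute.refl n).mul_right (.refl n))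
  have h₄ : 0 ≤ (n * n) * (n * q - n * n) := (hn'.mul_left hn').mul_nonneg hn2 h₂
  have h₅ : n * p * (n * q) = 0 := by
    rw [mul_assoc, ← mul_assoc p, ← hnp.eq, mul_assoc n p q, hpq, mul_zero, mul_zero]
  have h₆ : (n * n) * (n * n) = 0 := by
    refine le_antisymm ?_ ((Commute.refl _).mul_nonneg hn2 hn2)
    have := add_nonneg h₃ h₄
    rw [sub_mul, mul_sub, h₅] at this
    simpa using this
  have h₇ {s : H →L[ℂ] H} (hs : 0 ≤ s) (hss : s * s = 0) : s = 0 := by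
    rwa [← CStarRing.star_mul_self_eq_zero_iff, (IsSelfAdjoint.of_nonneg hs).star_eq]
  have h₈ : n = 0 := h₇ hn (h₇ hn2 h₆)
  exact sub_nonneg.mp ((CFC.negPart_eq_zero_iff t ht).mp h₈)

theorem partiallyOrthoCoexistent_of_commute (a b : H →L[ℂ] H)
    (ha : IsEffect a) (hb : IsEffect b) (hab : a * b = b * a) :
    PartiallyOrthoCoexistent a b := by
  obtain ⟨ha0, ha1⟩ := ha
  obtain ⟨hb0, hb1⟩ := hb
  have hd : IsSelfAdjoint (a - b) := (IsSelfAdjoint.of_nonneg ha0).sub (.of_nonneg hb0)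
  have hda : Commute (a - b) a := (Commute.refl a).sub_left (Commute.symm hab)
  have hpa : Commute (a - b)⁺ a := hda.cfcₙ_real _
  have hqa : Commute (a - b)⁻ a := hda.cfcₙ_real _
  have hp := CFC.posPart_nonneg (a - b)
  have hq := CFC.negPart_nonneg (a - b)
  have hpq := CFC.posPart_mul_negPart (a - b)
  have hqp := CFC.negPart_mul_posPart (a - b)
  have hsub := CFC.posPart_sub_negPart (a - b) hd
  generalize (a - b)⁺ = p at *
  generalize (a - b)⁻ = q at *
  have hb_eq : b = a - p + q := by
    rw [sub_add, hsub, sub_sub_cancel]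
  have hpa_le : p ≤ a := le_of_sub_le_of_mul_eq_zero ha0 hp hq hpq hpa.symm hqa.symm
    (by rw [hsub]; exact sub_le_self a hb0)
  have hqa_le : q ≤ 1 - a := le_of_sub_le_of_mul_eq_zero (sub_nonneg.mpr ha1) hq hp hqp
    ((Commute.one_left q).sub_left hqa.symm) ((Commute.one_left p).sub_left hpa.symm)
    (by rw [← neg_sub p q, hsub, neg_sub]; exact sub_le_sub_right hb1 a)
  refine ⟨a - p, p, q, ⟨sub_nonneg.mpr hpa_le, (sub_le_self a hp).trans ha1⟩,
    ⟨hp, hpa_le.trans ha1⟩, ⟨hq, hqa_le.trans (sub_le_self 1 ha0)⟩,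
    (sub_add_cancel a p).symm, hb_eq, ?_, hpq⟩
  rw [sub_add_cancel]
  exact ⟨add_nonneg ha0 hq, by rw [add_comm]; exact le_sub_iff_add_le.mp hqa_le⟩
end

section
/- Let a and b be effects on a complex Hilbert space H with a b = b a. Then I - a and b are partially ortho-coexistent. -/
variable {H : Type*} [NormedAddCommGroup H] [InnerProductSpace ℂ H] [CompleteSpace H]

/-- If a selfadjoint element `x` commutes with elements `y`, `z` such that `y * z = 0` and both
`x + y` and `x + z` are nonnegative, then `x` is nonnegative. -/
theorem IsSelfAdjoint.nonneg_of_add_nonneg_of_mul_eq_zero {A : Type*} [CStarAlgebra A]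
    [PartialOrder A] [StarOrderedRing A] {x y z : A} (hx : IsSelfAdjoint x)
    (hxy : Commute x y) (hxz : Commute x z) (hyz : Commute y z) (hmul : y * z = 0)
    (hy : 0 ≤ x + y) (hz : 0 ≤ x + z) : 0 ≤ x := by
  have hn : 0 ≤ x⁻ := CFC.negPart_nonneg x
  have hcomm {w : A} (hw : Commute x w) : Commute x⁻ w := hw.cfcₙ_real _
  have hnx : x⁻ * x = -(x⁻ * x⁻) := by
    nth_rw 2 [← CFC.posPart_sub_negPart x hx]
    rw [mul_sub, CFC.negPart_mul_posPart, zero_sub]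
  have hny := hcomm hxy
  have hnz := hcomm hxz
  have hxn : Commute x x⁻ := (hcomm (Commute.refl x)).symm
  have hu : 0 ≤ x⁻ * (x + y) := (hxn.symm.add_right hny).mul_nonneg hn hy
  have hv : 0 ≤ x⁻ * (x + z) := (hxn.symm.add_right hnz).mul_nonneg hn hz
  have hnn : 0 ≤ x⁻ * x⁻ := (Commute.refl _).mul_nonneg hn hn
  have hnu : Commute x⁻ (x⁻ * (x + y)) := (Commute.refl _).mul_right (hxn.symm.add_right hny)
  have hnv : Commute x⁻ (x⁻ * (x + z)) := (Commute.refl _).mul_right (hxn.symm.add_right hnz)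
  have huv : Commute (x⁻ * (x + y)) (x⁻ * (x + z)) :=
    hnv.mul_left ((hxn.add_left hny.symm).mul_right
      (((Commute.refl x).add_right hxz).add_left (hxy.symm.add_right hyz)))
  have hprod : (x⁻ * (x + y) + x⁻ * x⁻) * (x⁻ * (x + z) + x⁻ * x⁻) = 0 := by
    rw [mul_add x⁻ x y, hnx, neg_add_cancel_comm, mul_add x⁻ x z, hnx, neg_add_cancel_comm,
      hny.symm.mul_mul_mul_comm, hmul, mul_zero]
  have hfour : x⁻ * x⁻ * (x⁻ * x⁻) ≤ 0 := by
    have h1 := huv.mul_nonneg hu hv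
    have h2 := (hnu.mul_left hnu).symm.mul_nonneg hu hnn
    have h3 := (hnv.mul_left hnv).mul_nonneg hnn hv
    rw [← hprod, add_mul, mul_add (x⁻ * (x + y)), mul_add (x⁻ * x⁻), ← add_assoc]
    exact le_add_of_nonneg_left (add_nonneg (add_nonneg h1 h2) h3)
  have hzero : x⁻ * x⁻ * (x⁻ * x⁻) = 0 :=
    le_antisymm hfour ((Commute.refl _).mul_nonneg hnn hnn)
  have hsq : x⁻ * x⁻ = 0 := by
    rwa [← CStarRing.star_mul_self_eq_zero_iff, hnn.isSelfAdjoint.star_eq]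
  have hneg : x⁻ = 0 := by
    rwa [← CStarRing.star_mul_self_eq_zero_iff, hn.isSelfAdjoint.star_eq]
  rwa [CFC.negPart_eq_zero_iff x hx] at hneg

theorem partiallyOrthoCoexistent_compl_left_of_commute (a b : H →L[ℂ] H)
    (ha : IsEffect a) (hb : IsEffect b) (hab : a * b = b * a) :
    PartiallyOrthoCoexistent (1 - a) b := by
  obtain ⟨ha0, ha1⟩ := ha
  obtain ⟨hb0, hb1⟩ := hb
  have hab' : Commute a b := hab
  set c : H →L[ℂ] H := 1 - a - b
  have hcsa : IsSelfAdjoint c :=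
    ((IsSelfAdjoint.one _).sub ha0.isSelfAdjoint).sub hb0.isSelfAdjoint
  have hsub : c⁺ - c⁻ = 1 - a - b := CFC.posPart_sub_negPart c hcsa
  have hy0 : 0 ≤ c⁺ := CFC.posPart_nonneg c
  have hz0 : 0 ≤ c⁻ := CFC.negPart_nonneg c
  have hyz : c⁺ * c⁻ = 0 := CFC.posPart_mul_negPart c
  have hzy : c⁻ * c⁺ = 0 := CFC.negPart_mul_posPart c
  have hyzc : Commute c⁺ c⁻ := hyz.trans hzy.symm
  have hca : Commute c a :=
    ((Commute.one_left a).sub_left (Commute.refl a)).sub_left hab'.symm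
  have hcb : Commute c b :=
    ((Commute.one_left b).sub_left hab').sub_left (Commute.refl b)
  have hay : Commute a c⁺ := (hca.cfcₙ_real _).symm
  have haz : Commute a c⁻ := (hca.cfcₙ_real _).symm
  have hby : Commute b c⁺ := (hcb.cfcₙ_real _).symm
  have hbz : Commute b c⁻ := (hcb.cfcₙ_real _).symm
  have hxb : b - c⁻ = 1 - a - c⁺ := by
    rw [← sub_eq_zero] at hsub ⊢
    rw [← hsub]
    abel
  have hx0 : 0 ≤ b - c⁻ := by
    refine (hb0.isSelfAdjoint.sub hz0.isSelfAdjoint).nonneg_of_add_nonneg_of_mul_eq_zero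
      (hby.sub_left hyzc.symm) (hbz.sub_left (Commute.refl _)) hyzc hyz ?_ ?_
    · rw [hxb, sub_add_cancel]
      exact sub_nonneg.mpr ha1
    · rwa [sub_add_cancel]
  have hw0 : 0 ≤ a - c⁻ := by
    refine (ha0.isSelfAdjoint.sub hz0.isSelfAdjoint).nonneg_of_add_nonneg_of_mul_eq_zero
      (hay.sub_left hyzc.symm) (haz.sub_left (Commute.refl _)) hyzc hyz ?_ ?_
    · have : a - c⁻ + c⁺ = 1 - b := by
        rw [← sub_eq_zero] at hsub ⊢
        rw [← hsub]
        abel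
      rw [this]
      exact sub_nonneg.mpr hb1
    · rwa [sub_add_cancel]
  have hxyz : b - c⁻ + c⁺ + c⁻ = 1 - (a - c⁻) := by
    rw [hxb]; abel
  refine ⟨b - c⁻, c⁺, c⁻, ⟨hx0, (sub_le_self b hz0).trans hb1⟩, ⟨hy0, ?_⟩, ⟨hz0, ?_⟩, ?_, ?_,
    ⟨add_nonneg (add_nonneg hx0 hy0) hz0, ?_⟩, hyz⟩
  · refine le_trans ?_ (sub_le_self 1 ha0)
    rwa [hxb, sub_nonneg] at hx0
  · exact (sub_nonneg.mp hx0).trans hb1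
  · rw [hxb, sub_add_cancel]
  · rw [sub_add_cancel]
  · rw [hxyz]
    exact sub_le_self 1 hw0
end

section
/- Let a and b be effects on a complex Hilbert space H, and let x₀ ∈ B(H) be positive with ‖x₀‖ < 1, commuting with both a and b. If |a - b| + |I - a - b| = I - x₀, then (1/2)x₀ ≤ a ≤ I - (1/2)x₀ and (1/2)x₀ ≤ b ≤ I - (1/2)x₀. -/
variable {H : Type*} [NormedAddCommGroup H] [InnerProductSpace ℂ H] [CompleteSpace H]

theorem le_oabs_self {u : H →L[ℂ] H} (hu : IsSelfAdjoint u) : u ≤ oabs u := by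
  have h := CFC.abs_sub_self u hu
  rw [← sub_nonneg]
  change 0 ≤ CFC.abs u - u
  rw [h]
  exact nsmul_nonneg (CFC.negPart_nonneg u) 2

theorem neg_le_oabs_self {u : H →L[ℂ] H} (hu : IsSelfAdjoint u) : -u ≤ oabs u := by
  have h := CFC.abs_add_self u hu
  rw [← sub_nonneg, sub_neg_eq_add]
  change 0 ≤ CFC.abs u + u
  rw [h]
  exact nsmul_nonneg (CFC.posPart_nonneg u) 2

theorem half_smul_le_of_le_add_self {x a : H →L[ℂ] H} (h : x ≤ a + a) :
    ((1:ℂ)/2) • x ≤ a := by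
  have h₁ : (0 : H →L[ℂ] H) ≤ ((1:ℝ)/2) • (a + a - x) :=
    smul_nonneg (by norm_num) (sub_nonneg.mpr h)
  have h₂ : ((1:ℝ)/2) • (a + a - x) = a - ((1:ℂ)/2) • x := by
    rw [← Complex.coe_smul]
    push_cast
    module
  rwa [h₂, sub_nonneg] at h₁

theorem x0_compatible_bounds (a b x₀ : H →L[ℂ] H)
    (ha : IsEffect a) (hb : IsEffect b)
    (hx₀ : 0 ≤ x₀) (hx₀n : ‖x₀‖ < 1)
    (hca : x₀ * a = a * x₀) (hcb : x₀ * b = b * x₀)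
    (h : oabs (a - b) + oabs (1 - a - b) = 1 - x₀) :
    ((1:ℂ)/2) • x₀ ≤ a ∧ a ≤ 1 - ((1:ℂ)/2) • x₀ ∧
      ((1:ℂ)/2) • x₀ ≤ b ∧ b ≤ 1 - ((1:ℂ)/2) • x₀ := by
  have sa : IsSelfAdjoint a := .of_nonneg ha.1
  have sb : IsSelfAdjoint b := .of_nonneg hb.1
  have su : IsSelfAdjoint (a - b) := sa.sub sb
  have sv : IsSelfAdjoint (1 - a - b) := ((IsSelfAdjoint.one _).sub sa).sub sb
  have key {y z : H →L[ℂ] H} (hy : y ≤ oabs (a - b)) (hz : z ≤ oabs (1 - a - b))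
      (c : H →L[ℂ] H) (hc : c + c = 1 - (y + z)) : ((1:ℂ)/2) • x₀ ≤ c := by
    refine half_smul_le_of_le_add_self ?_
    rw [hc]
    exact le_sub_comm.mp (h ▸ add_le_add hy hz)
  exact ⟨key (neg_le_oabs_self su) (le_oabs_self sv) a (by abel),
    le_sub_comm.mp (key (le_oabs_self su) (neg_le_oabs_self sv) (1 - a) (by abel)),
    key (le_oabs_self su) (le_oabs_self sv) b (by abel),
    le_sub_comm.mp (key (neg_le_oabs_self su) (neg_le_oabs_self sv) (1 - b) (by abel))⟩
end

section
/- Let a and b be effects on a complex Hilbert space H, and let x₀ ∈ B(H) be positive with ‖x₀‖ < 1, commuting with both a and b. Since ‖x₀‖ < 1, the operator I - x₀ is invertible. Then |a - b| + |I - a - b| = I - x₀ if and only if the operators a₁ := (I - x₀)⁻¹(a - (1/2)x₀) and b₁ := (I - x₀)⁻¹(b - (1/2)x₀) satisfy |a₁ - b₁| + |I - a₁ - b₁| = I. -/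
variable {H : Type*} [NormedAddCommGroup H] [InnerProductSpace ℂ H] [CompleteSpace H]

theorem oabs_eq_abs (u : H →L[ℂ] H) : oabs u = CFC.abs u := rfl

/-- A positive operator commuting with `u` factors out of the absolute value of `u`. -/
theorem oabs_mul_of_nonneg_of_commute {c u : H →L[ℂ] H} (hc : 0 ≤ c) (h : Commute c u) :
    oabs (c * u) = c * oabs u := by
  have hs : star c = c := (IsSelfAdjoint.of_nonneg hc).star_eq
  have h' : Commute c (star u) := by simpa [hs] using h.star_star
  rw [oabs_eq_abs, oabs_eq_abs, h.cfcAbs_mul_eq h', CFC.abs_of_nonneg c hc]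

theorem Commute.ringInverse_left_of_isUnit {M : Type*} [MonoidWithZero M] {t u : M}
    (ht : IsUnit t) (h : Commute t u) : Commute (Ring.inverse t) u := by
  obtain ⟨v, rfl⟩ := ht
  rw [Ring.inverse_unit]
  exact h.units_inv_left

theorem x0_compatible_iff_absolutelyCompatible (a b x₀ : H →L[ℂ] H)
    (ha : IsEffect a) (hb : IsEffect b)
    (hx₀ : 0 ≤ x₀) (hx₀n : ‖x₀‖ < 1)
    (hca : x₀ * a = a * x₀) (hcb : x₀ * b = b * x₀) :
    oabs (a - b) + oabs (1 - a - b) = 1 - x₀ ↔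
      (let a₁ := Ring.inverse (1 - x₀) * (a - ((1:ℂ)/2) • x₀);
       let b₁ := Ring.inverse (1 - x₀) * (b - ((1:ℂ)/2) • x₀);
       oabs (a₁ - b₁) + oabs (1 - a₁ - b₁) = 1) := by
  have hu : IsUnit (1 - x₀) := isUnit_one_sub_of_norm_lt_one hx₀n
  have hle : x₀ ≤ 1 := (CStarAlgebra.norm_le_one_iff_of_nonneg x₀ hx₀).mp hx₀n.le
  have hc : 0 ≤ Ring.inverse (1 - x₀) :=
    (CFC.ringInverse_nonneg_iff_nonneg_of_isUnit hu).mpr (sub_nonneg.mpr hle)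
  have hcomm {u : H →L[ℂ] H} (h : Commute x₀ u) : Commute (Ring.inverse (1 - x₀)) u :=
    .ringInverse_left_of_isUnit hu ((Commute.one_left u).sub_left h)
  have hxa : Commute x₀ a := hca
  have hxb : Commute x₀ b := hcb
  have hinv := Ring.inverse_mul_cancel (1 - x₀) hu
  have hhalf : ((1:ℂ)/2) • x₀ + ((1:ℂ)/2) • x₀ = x₀ := by
    rw [← add_smul]; norm_num
  have hdiff : Ring.inverse (1 - x₀) * (a - ((1:ℂ)/2) • x₀)
      - Ring.inverse (1 - x₀) * (b - ((1:ℂ)/2) • x₀) = Ring.inverse (1 - x₀) * (a - b) := by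
    rw [← mul_sub, sub_sub_sub_cancel_right]
  have hsum : 1 - Ring.inverse (1 - x₀) * (a - ((1:ℂ)/2) • x₀)
      - Ring.inverse (1 - x₀) * (b - ((1:ℂ)/2) • x₀) = Ring.inverse (1 - x₀) * (1 - a - b) := by
    nth_rewrite 1 [← hinv]
    rw [← mul_sub, ← mul_sub]
    congr 1
    nth_rewrite 1 [← hhalf]
    abel
  change _ ↔ oabs (_ - _) + oabs (1 - _ - _) = 1
  rw [hdiff, hsum, oabs_mul_of_nonneg_of_commute hc (hcomm (hxa.sub_right hxb)),
    oabs_mul_of_nonneg_of_commute hc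
      (hcomm (((Commute.one_right x₀).sub_right hxa).sub_right hxb)), ← mul_add,
    Ring.inverse_mul_eq_iff_eq_mul _ _ _ hu, mul_one]
end

section
/- Let a and b be effects on a complex Hilbert space H, and let x₀ ∈ B(H) be positive with ‖x₀‖ < 1, commuting with both a and b. If |a - b| + |I - a - b| = I - x₀, then a and b are partially ortho-coexistent. -/
variable {H : Type*} [NormedAddCommGroup H] [InnerProductSpace ℂ H] [CompleteSpace H]

lemma oabs_eq_posPart_add_negPart {u : H →L[ℂ] H} (hu : IsSelfAdjoint u) :
    oabs u = u⁺ + u⁻ :=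
  (CFC.posPart_add_negPart u hu).symm

theorem x0_compatible_partiallyOrthoCoexistent (a b x₀ : H →L[ℂ] H)
    (ha : IsEffect a) (hb : IsEffect b)
    (hx₀ : 0 ≤ x₀) (hx₀n : ‖x₀‖ < 1)
    (hca : x₀ * a = a * x₀) (hcb : x₀ * b = b * x₀)
    (h : oabs (a - b) + oabs (1 - a - b) = 1 - x₀) :
    PartiallyOrthoCoexistent a b := by
  have hsa : IsSelfAdjoint a := .of_nonneg ha.1
  have hsb : IsSelfAdjoint b := .of_nonneg hb.1
  have hu : IsSelfAdjoint (a - b) := hsa.sub hsb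
  have hv : IsSelfAdjoint (1 - a - b) := ((IsSelfAdjoint.one _).sub hsa).sub hsb
  rw [oabs_eq_posPart_add_negPart hu, oabs_eq_posPart_add_negPart hv] at h
  have hy : 0 ≤ (a - b)⁺ := CFC.posPart_nonneg _
  have hz : 0 ≤ (a - b)⁻ := CFC.negPart_nonneg _
  have hp : 0 ≤ (1 - a - b)⁺ := CFC.posPart_nonneg _
  have hn : 0 ≤ (1 - a - b)⁻ := CFC.negPart_nonneg _
  have hyz : (a - b)⁺ * (a - b)⁻ = 0 := CFC.posPart_mul_negPart _
  have hu' : (a - b)⁺ - (a - b)⁻ = a - b := CFC.posPart_sub_negPart _ hu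
  have hv' : (1 - a - b)⁺ - (1 - a - b)⁻ = 1 - a - b := CFC.posPart_sub_negPart _ hv
  generalize (a - b)⁺ = y at *
  generalize (a - b)⁻ = z at *
  generalize (1 - a - b)⁺ = p at *
  generalize (1 - a - b)⁻ = n at *
  have hhalf : 0 ≤ (2⁻¹ : ℝ) • x₀ := smul_nonneg (by norm_num) hx₀
  have hxeq : a - y = n + (2⁻¹ : ℝ) • x₀ := by
    linear_combination (norm := module) (-2⁻¹ : ℝ) • h - (2⁻¹ : ℝ) • hu' + (2⁻¹ : ℝ) • hv'
  have hweq : 1 - (a + z) = p + (2⁻¹ : ℝ) • x₀ := by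
    linear_combination (norm := module) (-2⁻¹ : ℝ) • h + (2⁻¹ : ℝ) • hu' - (2⁻¹ : ℝ) • hv'
  have hx : 0 ≤ a - y := hxeq ▸ add_nonneg hn hhalf
  have hw : a + z ≤ 1 := sub_nonneg.1 (hweq ▸ add_nonneg hp hhalf)
  have hb' : b = a - y + z := by
    rw [← sub_eq_zero, ← sub_eq_zero.2 hu']; abel
  refine ⟨a - y, y, z, ⟨hx, (sub_le_self a hy).trans ha.2⟩, ⟨hy, (sub_nonneg.1 hx).trans ha.2⟩,
    ⟨hz, (le_add_of_nonneg_left ha.1).trans hw⟩, (sub_add_cancel a y).symm, hb', ?_, hyz⟩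
  rw [sub_add_cancel]
  exact ⟨add_nonneg ha.1 hz, hw⟩
end

section
/- Let M be a von Neumann algebra on a complex Hilbert space H, let v ∈ M be positive with ‖v‖ ≤ 1, and let x ∈ M be positive with ‖x‖ < 1 and lying in the commutant of M (so x is central). Then the following are equivalent: (1) v is strict in M; (2) for every positive central x ∈ M with ‖x‖ < 1, both (1 - x)v and (1 - x)(1 - v) are strict in M; (3) there exists a positive central x ∈ M with ‖x‖ < 1 such that both (1 - x)v and (1 - x)(1 - v) are strict in M. -/
variable {H : Type*} [NormedAddCommGroup H] [InnerProductSpace ℂ H] [CompleteSpace H]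

/-- An element v of a von Neumann algebra M is strict in M if the only projection of M
below it is 0 and the only projection of M above it is 1. -/
def IsStrictIn (M : VonNeumannAlgebra H) (v : H →L[ℂ] H) : Prop :=
  ∀ p : H →L[ℂ] H, p ∈ M → IsSelfAdjoint p → IsIdempotentElem p →
    (p ≤ v → p = 0) ∧ (v ≤ p → p = 1)

/-- An element is central in M if it commutes with every element of M. -/
def IsCentralIn (M : VonNeumannAlgebra H) (x : H →L[ℂ] H) : Prop :=
  ∀ m ∈ M, x * m = m * x

section CStarAlgebra

variable {A : Type*} [CStarAlgebra A] [PartialOrder A] [StarOrderedRing A]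

theorem mul_one_sub_eq_zero_of_le_projection {a p : A} (ha : 0 ≤ a) (hp : IsSelfAdjoint p)
    (hpp : IsIdempotentElem p) (hap : a ≤ p) : a * (1 - p) = 0 := by
  have hq : IsSelfAdjoint (1 - p) := (IsSelfAdjoint.one A).sub hp
  have h1 : star (1 - p) * a * (1 - p) ≤ star (1 - p) * p * (1 - p) :=
    star_left_conjugate_le_conjugate hap _
  have h0 : p * (1 - p) = 0 := by rw [mul_sub, mul_one, hpp.eq, sub_self]
  rw [mul_assoc _ p, h0, mul_zero] at h1
  have h2 : star (1 - p) * a * (1 - p) = 0 := le_antisymm h1 (star_left_conjugate_nonneg ha _)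
  obtain ⟨b, rfl⟩ := CStarAlgebra.nonneg_iff_eq_star_mul_self.mp ha
  have h3 : star (b * (1 - p)) * (b * (1 - p)) = 0 := by
    rw [star_mul]
    simpa only [mul_assoc] using h2
  rw [mul_assoc, CStarRing.star_mul_self_eq_zero_iff _ |>.mp h3, mul_zero]

theorem le_projection_of_mul_one_sub_eq_zero {v p : A} (hv0 : 0 ≤ v) (hv1 : v ≤ 1)
    (hp : IsSelfAdjoint p) (hpp : IsIdempotentElem p) (h : v * (1 - p) = 0) : v ≤ p := by
  have hvp : v * p = v := by
    rw [mul_sub, mul_one, sub_eq_zero] at h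
    exact h.symm
  have hpv : p * v = v := by
    have := congrArg star hvp
    rwa [star_mul, hp.star_eq, (IsSelfAdjoint.of_nonneg hv0).star_eq] at this
  have h1 : star p * v * p ≤ star p * 1 * p := star_left_conjugate_le_conjugate hv1 _
  rwa [hp.star_eq, hpv, hvp, mul_one, hpp.eq] at h1

theorem one_sub_mul_le_of_commute {v y : A} (hv : 0 ≤ v) (hy : 0 ≤ y) (h : Commute y v) :
    (1 - y) * v ≤ v := by
  rw [sub_mul, one_mul]
  exact sub_le_self _ (Commute.mul_nonneg hy hv h)

theorem one_sub_mul_nonneg_of_commute {v y : A} (hv : 0 ≤ v) (hy1 : y ≤ 1) (h : Commute y v) :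
    0 ≤ (1 - y) * v :=
  Commute.mul_nonneg (sub_nonneg.mpr hy1) hv ((Commute.one_left v).sub_left h)

end CStarAlgebra

theorem IsStrictIn.one_sub {M : VonNeumannAlgebra H} {v : H →L[ℂ] H} (hs : IsStrictIn M v) :
    IsStrictIn M (1 - v) := by
  intro p hpM hp hpp
  obtain ⟨h0, h1⟩ := hs (1 - p) (sub_mem (one_mem M) hpM) ((IsSelfAdjoint.one _).sub hp)
    hpp.one_sub
  exact ⟨fun h => sub_eq_self.mp (h1 (le_sub_comm.mp h)),
    fun h => (sub_eq_zero.mp (h0 (sub_le_comm.mp h))).symm⟩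

theorem IsStrictIn.one_sub_mul {M : VonNeumannAlgebra H} {v y : H →L[ℂ] H}
    (hs : IsStrictIn M v) (hv0 : 0 ≤ v) (hv1 : v ≤ 1) (hy0 : 0 ≤ y) (hyn : ‖y‖ < 1)
    (hc : Commute y v) : IsStrictIn M ((1 - y) * v) := by
  have hy1 : y ≤ 1 := (CStarAlgebra.norm_le_one_iff_of_nonneg y hy0).mp hyn.le
  intro p hpM hp hpp
  refine ⟨fun h => (hs p hpM hp hpp).1 (h.trans (one_sub_mul_le_of_commute hv0 hy0 hc)),
    fun h => (hs p hpM hp hpp).2 ?_⟩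
  have h0 := mul_one_sub_eq_zero_of_le_projection
    (one_sub_mul_nonneg_of_commute hv0 hy1 hc) hp hpp h
  rw [mul_assoc, (isUnit_one_sub_of_norm_lt_one hyn).mul_right_eq_zero] at h0
  exact le_projection_of_mul_one_sub_eq_zero hv0 hv1 hp hpp h0

theorem IsStrictIn.of_one_sub_mul {M : VonNeumannAlgebra H} {v y : H →L[ℂ] H}
    (hv0 : 0 ≤ v) (hv1 : v ≤ 1) (hy0 : 0 ≤ y) (hc : Commute y v)
    (h : IsStrictIn M ((1 - y) * v)) (h' : IsStrictIn M ((1 - y) * (1 - v))) :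
    IsStrictIn M v := by
  intro p hpM hp hpp
  refine ⟨fun hpv => ?_, fun hvp => (h p hpM hp hpp).2
    ((one_sub_mul_le_of_commute hv0 hy0 hc).trans hvp)⟩
  have hle : (1 - y) * (1 - v) ≤ 1 - v := one_sub_mul_le_of_commute (sub_nonneg.mpr hv1) hy0
    ((Commute.one_right y).sub_right hc)
  exact sub_eq_self.mp ((h' (1 - p) (sub_mem (one_mem M) hpM) ((IsSelfAdjoint.one _).sub hp)
    hpp.one_sub).2 (hle.trans (sub_le_sub_left hpv 1)))

theorem strict_iff_strict_of_central (M : VonNeumannAlgebra H) (v x : H →L[ℂ] H)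
    (hv : v ∈ M) (hv0 : 0 ≤ v) (hvn : ‖v‖ ≤ 1)
    (hx : x ∈ M) (hx0 : 0 ≤ x) (hxn : ‖x‖ < 1) (hxc : IsCentralIn M x) :
    (IsStrictIn M v ↔
      ∀ y : H →L[ℂ] H, y ∈ M → 0 ≤ y → ‖y‖ < 1 → IsCentralIn M y →
        IsStrictIn M ((1 - y) * v) ∧ IsStrictIn M ((1 - y) * (1 - v))) ∧
    (IsStrictIn M v ↔
      ∃ y : H →L[ℂ] H, y ∈ M ∧ 0 ≤ y ∧ ‖y‖ < 1 ∧ IsCentralIn M y ∧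
        IsStrictIn M ((1 - y) * v) ∧ IsStrictIn M ((1 - y) * (1 - v))) := by
  have hv1 : v ≤ 1 := (CStarAlgebra.norm_le_one_iff_of_nonneg v hv0).mp hvn
  have forward (hs : IsStrictIn M v) (y : H →L[ℂ] H) (hy0 : 0 ≤ y) (hyn : ‖y‖ < 1)
      (hyc : IsCentralIn M y) :
      IsStrictIn M ((1 - y) * v) ∧ IsStrictIn M ((1 - y) * (1 - v)) :=
    ⟨hs.one_sub_mul hv0 hv1 hy0 hyn (hyc v hv),
      hs.one_sub.one_sub_mul (sub_nonneg.mpr hv1) (sub_le_self 1 hv0) hy0 hyn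
        (hyc (1 - v) (sub_mem (one_mem M) hv))⟩
  refine ⟨⟨fun hs y _ hy0 hyn hyc => forward hs y hy0 hyn hyc, fun h => ?_⟩,
    ⟨fun hs => ⟨x, hx, hx0, hxn, hxc, forward hs x hx0 hxn hxc⟩, ?_⟩⟩
  · obtain ⟨h1, h2⟩ := h x hx hx0 hxn hxc
    exact IsStrictIn.of_one_sub_mul hv0 hv1 hx0 (hxc v hv) h1 h2
  · rintro ⟨y, -, hy0, -, hyc, h1, h2⟩
    exact IsStrictIn.of_one_sub_mul hv0 hv1 hy0 (hyc v hv) h1 h2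
end

section
/- Let H be a complex Hilbert space with identity operator I, let p and q be projections in B(H), let x₀, w₁, w₂ ∈ B(H) be positive operators such that w₁ + w₂ = I - x₀, ‖x₀‖ < 1, w₁ commutes with p, w₂ commutes with q, and each of x₀, w₁, w₂ commutes with each of p, q and with one another. Define a := (1/2)x₀ + w₁ p + w₂ q and b := (1/2)x₀ + w₁ p + w₂ (I - q). Then |a - b| + |I - a - b| = I - x₀, i.e., a is x₀-compatible with b. -/
variable {H : Type*} [NormedAddCommGroup H] [InnerProductSpace ℂ H] [CompleteSpace H]

theorem oabs_mul_self_add_self_sub_one {w p : H →L[ℂ] H} (hw : 0 ≤ w) (hp : IsSelfAdjoint p)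
    (hpp : IsIdempotentElem p) (hwp : w * p = p * w) : oabs (w * (p + p - 1)) = w := by
  have hsq : (p + p - 1) * (p + p - 1) = 1 := by
    have h : p * p = p := hpp
    simp only [sub_mul, mul_sub, add_mul, mul_add, h, mul_one, one_mul]
    abel
  have hcomm : w * (p + p - 1) = (p + p - 1) * w := by
    simp only [sub_mul, mul_sub, add_mul, mul_add, hwp, mul_one, one_mul]
  refine CFC.sqrt_unique ?_ hw
  rw [star_mul, star_sub, star_add, hp.star_eq, star_one, (IsSelfAdjoint.of_nonneg hw).star_eq,
    ← hcomm, mul_assoc, hcomm, ← mul_assoc (p + p - 1), hsq, one_mul]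

theorem oabs_neg (u : H →L[ℂ] H) : oabs (-u) = oabs u := by
  simp [oabs]

theorem x0_compatible_of_decomposition (p q x₀ w₁ w₂ : H →L[ℂ] H)
    (hp₁ : IsSelfAdjoint p) (hp₂ : IsIdempotentElem p)
    (hq₁ : IsSelfAdjoint q) (hq₂ : IsIdempotentElem q)
    (hx₀ : 0 ≤ x₀) (hw₁ : 0 ≤ w₁) (hw₂ : 0 ≤ w₂)
    (hsum : w₁ + w₂ = 1 - x₀) (hx₀n : ‖x₀‖ < 1)
    (hx₀p : x₀ * p = p * x₀) (hx₀q : x₀ * q = q * x₀)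
    (hw₁p : w₁ * p = p * w₁) (hw₁q : w₁ * q = q * w₁)
    (hw₂p : w₂ * p = p * w₂) (hw₂q : w₂ * q = q * w₂)
    (hx₀w₁ : x₀ * w₁ = w₁ * x₀) (hx₀w₂ : x₀ * w₂ = w₂ * x₀)
    (hw₁w₂ : w₁ * w₂ = w₂ * w₁) :
    oabs ((((1:ℂ)/2) • x₀ + w₁ * p + w₂ * q) - (((1:ℂ)/2) • x₀ + w₁ * p + w₂ * (1 - q)))
      + oabs (1 - (((1:ℂ)/2) • x₀ + w₁ * p + w₂ * q)
              - (((1:ℂ)/2) • x₀ + w₁ * p + w₂ * (1 - q))) = 1 - x₀ := by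
  have hhalf : ((1:ℂ)/2) • x₀ + ((1:ℂ)/2) • x₀ = x₀ := by
    rw [← add_smul]
    norm_num
  have hx : x₀ = 1 - w₁ - w₂ := by
    rw [sub_sub, hsum]
    abel
  have hsub : (((1:ℂ)/2) • x₀ + w₁ * p + w₂ * q) - (((1:ℂ)/2) • x₀ + w₁ * p + w₂ * (1 - q))
      = w₂ * (q + q - 1) := by
    simp only [mul_sub, mul_add, mul_one]
    abel
  have hcompl : 1 - (((1:ℂ)/2) • x₀ + w₁ * p + w₂ * q)
      - (((1:ℂ)/2) • x₀ + w₁ * p + w₂ * (1 - q)) = -(w₁ * (p + p - 1)) := by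
    calc
      _ = 1 - (((1:ℂ)/2) • x₀ + ((1:ℂ)/2) • x₀) - w₁ * p - w₁ * p - w₂ := by
        simp only [mul_sub, mul_one]
        abel
      _ = _ := by
        rw [hhalf, hx]
        simp only [mul_sub, mul_add, mul_one]
        abel
  rw [hsub, hcompl, oabs_neg, oabs_mul_self_add_self_sub_one hw₂ hq₁ hq₂ hw₂q,
    oabs_mul_self_add_self_sub_one hw₁ hp₁ hp₂ hw₁p, add_comm, hsum]
end

section
/- Let P and Q be projections in the algebra M₂(ℂ) of 2×2 complex matrices with P ≠ 0, P ≠ I₂, Q ≠ 0, Q ≠ I₂, and let α, β ∈ [0,1] satisfy 2α - αβ ≤ 1. Define A := (1-α)P + α(1-β)(I₂ - P) + αβ Q and B := (1-α)P + α(1-β)(I₂ - P) + αβ(I₂ - Q). Then |A - B| + |I₂ - A - B| = (1 - 2α(1-β)) I₂; that is, A is λ-compatible with B for λ = 2α(1-β). -/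
set_option synthInstance.maxHeartbeats 1000000
set_option maxHeartbeats 1000000
/-- The absolute value of an operator on ℂ². -/
noncomputable def oabs₂ (u : EuclideanSpace ℂ (Fin 2) →L[ℂ] EuclideanSpace ℂ (Fin 2)) :
    EuclideanSpace ℂ (Fin 2) →L[ℂ] EuclideanSpace ℂ (Fin 2) :=
  CFC.sqrt (star u * u)

open scoped ComplexOrder in
theorem oabs₂_smul_one_sub_two_smul
    (P : EuclideanSpace ℂ (Fin 2) →L[ℂ] EuclideanSpace ℂ (Fin 2))
    (hP₁ : IsSelfAdjoint P) (hP₂ : IsIdempotentElem P) (c : ℝ) (hc : 0 ≤ c) :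
    oabs₂ ((c : ℂ) • (1 - (2 : ℂ) • P)) = (c : ℂ) • 1 := by
  have h_sq : (1 - (2 : ℂ) • P) * (1 - (2 : ℂ) • P) = 1 := by
    simp only [sub_mul, mul_sub, one_mul, mul_one, smul_mul_assoc, mul_smul_comm, hP₂.eq]
    module
  have h_star : star ((c : ℂ) • (1 - (2 : ℂ) • P)) = (c : ℂ) • (1 - (2 : ℂ) • P) := by
    have h_two : star ((2 : ℂ) • P) = (2 : ℂ) • P := by
      rw [star_smul, hP₁.star_eq]
      simp
    have h_sub : star (1 - (2 : ℂ) • P) = 1 - (2 : ℂ) • P := by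
      rw [ContinuousLinearMap.star_eq_adjoint, map_sub, ← ContinuousLinearMap.star_eq_adjoint,
        ← ContinuousLinearMap.star_eq_adjoint, star_one, h_two]
    rw [star_smul, h_sub]
    simp
  have h_nonneg :
      0 ≤ (c : ℂ) • (1 : EuclideanSpace ℂ (Fin 2) →L[ℂ] EuclideanSpace ℂ (Fin 2)) := by
    rw [ContinuousLinearMap.nonneg_iff_isPositive]
    exact ContinuousLinearMap.isPositive_one.smul_of_nonneg (Complex.zero_le_real.mpr hc)
  rw [oabs₂, h_star, smul_mul_smul_comm, h_sq, ← CFC.sqrt_mul_self _ h_nonneg,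
    smul_mul_smul_comm, one_mul]

theorem lambda_compatible_of_internal_couple
    (P Q : EuclideanSpace ℂ (Fin 2) →L[ℂ] EuclideanSpace ℂ (Fin 2))
    (hP₁ : IsSelfAdjoint P) (hP₂ : IsIdempotentElem P) (hP0 : P ≠ 0) (hP1 : P ≠ 1)
    (hQ₁ : IsSelfAdjoint Q) (hQ₂ : IsIdempotentElem Q) (hQ0 : Q ≠ 0) (hQ1 : Q ≠ 1)
    (α β : ℝ) (hα : α ∈ Set.Icc (0:ℝ) 1) (hβ : β ∈ Set.Icc (0:ℝ) 1)
    (hαβ : 2*α - α*β ≤ 1)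
    (A B : EuclideanSpace ℂ (Fin 2) →L[ℂ] EuclideanSpace ℂ (Fin 2))
    (hA : A = ((1 - α : ℝ) : ℂ) • P + ((α * (1 - β) : ℝ) : ℂ) • (1 - P)
            + ((α * β : ℝ) : ℂ) • Q)
    (hB : B = ((1 - α : ℝ) : ℂ) • P + ((α * (1 - β) : ℝ) : ℂ) • (1 - P)
            + ((α * β : ℝ) : ℂ) • (1 - Q)) :
    oabs₂ (A - B) + oabs₂ (1 - A - B) = ((1 - 2 * α * (1 - β) : ℝ) : ℂ) • 1 := by
  have h_diff : A - B = ((α * β : ℝ) : ℂ) • (1 - (2 : ℂ) • (1 - Q)) := by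
    rw [hA, hB]
    module
  have h_sum : 1 - A - B = ((1 - 2 * α + α * β : ℝ) : ℂ) • (1 - (2 : ℂ) • P) := by
    rw [hA, hB]
    push_cast
    module
  have hQ : IsSelfAdjoint (1 - Q) := by
    rw [IsSelfAdjoint, ContinuousLinearMap.star_eq_adjoint, map_sub,
      ← ContinuousLinearMap.star_eq_adjoint, ← ContinuousLinearMap.star_eq_adjoint, star_one,
      hQ₁.star_eq]
  rw [h_diff, h_sum, oabs₂_smul_one_sub_two_smul _ hQ hQ₂.one_sub _ (mul_nonneg hα.1 hβ.1),
    oabs₂_smul_one_sub_two_smul _ hP₁ hP₂ _ (by linarith)]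
  push_cast
  module
end

section
/- Let x and y be positive operators on a complex Hilbert space H. Then x y = 0 if and only if |x - y| = x + y. -/
variable {H : Type*} [NormedAddCommGroup H] [InnerProductSpace ℂ H] [CompleteSpace H]

/-- If a positive operator anticommutes with another operator, their product is zero. -/
theorem mul_eq_zero_of_mul_add_mul_eq_zero {x y : H →L[ℂ] H} (hx : 0 ≤ x)
    (h : x * y + y * x = 0) : x * y = 0 := by
  have hanti : x * y = -(y * x) := eq_neg_of_add_eq_zero_left h
  have hsq : Commute (x * x) y := by
    change x * x * y = y * (x * x)
    rw [mul_assoc, hanti, mul_neg, ← mul_assoc, hanti, neg_mul, neg_neg, mul_assoc]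
  have hcomm : Commute x y := by
    have hsqrt := hsq.cfc_nnreal NNReal.sqrt
    rwa [← CFC.sqrt_eq_cfc, CFC.sqrt_mul_self x hx] at hsqrt
  rw [← hcomm.eq, ← two_smul ℂ] at h
  exact (smul_eq_zero.mp h).resolve_left two_ne_zero

theorem mul_eq_zero_iff_oabs_sub_eq_add (x y : H →L[ℂ] H)
    (hx : 0 ≤ x) (hy : 0 ≤ y) :
    x * y = 0 ↔ oabs (x - y) = x + y := by
  have hxs : star x = x := (IsSelfAdjoint.of_nonneg hx).star_eq
  have hys : star y = y := (IsSelfAdjoint.of_nonneg hy).star_eq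
  have hsq : oabs (x - y) = x + y ↔ (x + y) * (x + y) = (x - y) * (x - y) := by
    rw [oabs, CFC.sqrt_eq_iff _ _ (star_mul_self_nonneg _) (add_nonneg hx hy),
      star_sub, hxs, hys]
  rw [hsq]
  constructor
  · intro h
    have h' : y * x = 0 := by simpa [hxs, hys] using congrArg star h
    simp [add_mul, mul_add, sub_mul, mul_sub, h, h']
  · intro h
    apply mul_eq_zero_of_mul_add_mul_eq_zero hx
    have h2 : (2 : ℂ) • (x * y + y * x) = 0 := by
      rw [← sub_eq_zero] at h
      rw [← h, two_smul]
      noncomm_ring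
    exact (smul_eq_zero.mp h2).resolve_left two_ne_zero
end
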